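/- arXiv:2602.01403 — 2 statements merged into one kernel-verified Lean document; each statement's English description precedes it below -/
import Mathlib

section
/- (Babuška–Brezzi) Let Σ and V be real Hilbert spaces, and let a : Σ × Σ → ℝ and b : Σ × V → ℝ be continuous bilinear forms. Let Z = { σ ∈ Σ : b(σ, v) = 0 for all v ∈ V }. Assume a is Z-elliptic, i.e. there exists α > 0 with a(σ, σ) ≥ α‖σ‖²_Σ for all σ ∈ Z, and assume b satisfies the inf-sup condition: there exists β > 0 such that for every v ∈ V, sup_{τ ∈ Σ, τ ≠ 0} b(τ, v)/‖τ‖_Σ ≥ β‖v‖_V. Then for every κ ∈ Σ and l ∈ V there exists a unique pair (σ, u) ∈ Σ × V such that a(σ, τ) + b(τ, u) = ⟨κ, τ⟩_Σ for all τ ∈ Σ, and b(σ, v) = ⟨l, v⟩_V for all v ∈ V. -/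
open scoped RealInnerProductSpace

open ContinuousLinearMap in
/-- **Lax–Milgram**, operator form: a coercive operator on a real Hilbert space is surjective. -/
theorem surjective_of_coercive {H : Type*} [NormedAddCommGroup H] [InnerProductSpace ℝ H]
    [CompleteSpace H] (A : H →L[ℝ] H) {α : ℝ} (hα : 0 < α)
    (hA : ∀ x, α * ‖x‖ ^ 2 ≤ ⟪A x, x⟫) : Function.Surjective A := by
  have hc : IsCoercive ((innerSL ℝ).comp A : H →L[ℝ] H →L[ℝ] ℝ) :=
    ⟨α, hα, fun x => by simpa [pow_two, mul_assoc] using hA x⟩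
  intro f
  refine ⟨hc.continuousLinearEquivOfBilin.symm f, ext_inner_right ℝ fun w => ?_⟩
  have h := hc.continuousLinearEquivOfBilin_apply (hc.continuousLinearEquivOfBilin.symm f) w
  simpa using h.symm

/-- An inf-sup lower bound on a linear functional bounds the norm of its Riesz representative. -/
theorem le_norm_of_le_iSup_inner_div_norm {E : Type*} [NormedAddCommGroup E]
    [InnerProductSpace ℝ E] {x : E} {c : ℝ}
    (h : c ≤ ⨆ τ : {τ : E // τ ≠ 0}, ⟪x, (τ : E)⟫ / ‖(τ : E)‖) : c ≤ ‖x‖ :=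
  h.trans <| Real.iSup_le (fun τ => by
    rw [div_le_iff₀ (norm_pos_iff.2 τ.2)]
    exact real_inner_le_norm x τ) (norm_nonneg x)

open ContinuousLinearMap in
/-- Solvability of the saddle point system `A σ + B u = κ`, `B† σ = l`. -/
theorem exists_saddle_point {E V : Type*}
    [NormedAddCommGroup E] [InnerProductSpace ℝ E] [CompleteSpace E]
    [NormedAddCommGroup V] [InnerProductSpace ℝ V] [CompleteSpace V]
    (A : E →L[ℝ] E) (B : V →L[ℝ] E) {α β : ℝ} (hα : 0 < α) (hβ : 0 < β)
    (hA : ∀ σ, adjoint B σ = 0 → α * ‖σ‖ ^ 2 ≤ ⟪A σ, σ⟫)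
    (hB : ∀ v, β * ‖v‖ ≤ ‖B v‖) (κ : E) (l : V) :
    ∃ (σ : E) (u : V), A σ + B u = κ ∧ adjoint B σ = l := by
  have hS : Function.Surjective (adjoint B ∘L B) :=
    surjective_of_coercive _ (pow_pos hβ 2) fun v => by
      rw [comp_apply, adjoint_inner_left, real_inner_self_eq_norm_sq, ← mul_pow]
      exact pow_le_pow_left₀ (by positivity) (hB v) 2
  let Z : Submodule ℝ E := (adjoint B).ker
  have : CompleteSpace Z := (adjoint B).isClosed_ker.completeSpace_coe
  have hZ : Function.Surjective (adjoint Z.subtypeL ∘L A ∘L Z.subtypeL) :=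
    surjective_of_coercive _ hα fun z => by
      simpa [adjoint_inner_left] using hA z z.2
  obtain ⟨s, hs⟩ := hS l
  obtain ⟨z, hz⟩ := hZ (adjoint Z.subtypeL (κ - A (B s)))
  have hz0 : adjoint B z = 0 := z.2
  set r := κ - A (B s + z) with hr
  have hr_orth : ∀ w, adjoint B w = 0 → ⟪r, w⟫ = 0 := fun w hw => by
    have h := congrArg (fun y => ⟪y, (⟨w, hw⟩ : Z)⟫) hz
    simp only [comp_apply, adjoint_inner_left, Submodule.subtypeL_apply] at h
    rw [hr, map_add, ← sub_sub, inner_sub_left, h, sub_self]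
  obtain ⟨u, hu⟩ := hS (adjoint B r)
  rw [comp_apply] at hs hu
  have hd : adjoint B (r - B u) = 0 := by rw [map_sub, hu, sub_self]
  have hru : r - B u = 0 := by
    rw [← inner_self_eq_zero (𝕜 := ℝ), inner_sub_left, hr_orth _ hd,
      ← adjoint_inner_right, hd, inner_zero_right, sub_zero]
  refine ⟨B s + z, u, ?_, by rw [map_add, hs, hz0, add_zero]⟩
  rw [← sub_eq_zero.1 hru, hr]
  abel

/-- **Babuška–Brezzi theorem.**
Let `E` (the space `Σ` of the paper) and `V` be real Hilbert spaces,
`a : E × E → ℝ` and `b : E × V → ℝ` continuous bilinear forms, and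
`Z = {σ ∈ E : b(σ,v) = 0 ∀ v}`. If `a` is `Z`-elliptic
(`∃ α > 0, a(σ,σ) ≥ α‖σ‖² on Z`) and `b` satisfies the inf-sup condition
(`∃ β > 0, ∀ v, sup_{τ ≠ 0} b(τ,v)/‖τ‖ ≥ β‖v‖`), then for every `κ ∈ E` and
`l ∈ V` there exists a unique pair `(σ, u)` with `a(σ,τ) + b(τ,u) = ⟨κ,τ⟩_E`
for all `τ` and `b(σ,v) = ⟨l,v⟩_V` for all `v`. -/
theorem babuska_brezzi
    {E V : Type*}
    [NormedAddCommGroup E] [InnerProductSpace ℝ E] [CompleteSpace E]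
    [NormedAddCommGroup V] [InnerProductSpace ℝ V] [CompleteSpace V]
    (a : E →ₗ[ℝ] E →ₗ[ℝ] ℝ) (b : E →ₗ[ℝ] V →ₗ[ℝ] ℝ)
    (ha_cont : ∃ C : ℝ, ∀ σ τ : E, |a σ τ| ≤ C * ‖σ‖ * ‖τ‖)
    (hb_cont : ∃ C : ℝ, ∀ (τ : E) (v : V), |b τ v| ≤ C * ‖τ‖ * ‖v‖)
    (ha_ell : ∃ α > (0:ℝ), ∀ σ : E, (∀ v : V, b σ v = 0) → α * ‖σ‖ ^ 2 ≤ a σ σ)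
    (hb_infsup : ∃ β > (0:ℝ), ∀ v : V,
      β * ‖v‖ ≤ ⨆ τ : {τ : E // τ ≠ 0}, b (τ : E) v / ‖(τ : E)‖) :
    ∀ (κ : E) (l : V), ∃! p : E × V,
      (∀ τ : E, a p.1 τ + b τ p.2 = ⟪κ, τ⟫) ∧ (∀ v : V, b p.1 v = ⟪l, v⟫) := by
  obtain ⟨Ca, hCa⟩ := ha_cont
  obtain ⟨Cb, hCb⟩ := hb_cont
  obtain ⟨α, hα, hell⟩ := ha_ell
  obtain ⟨β, hβ, hinf⟩ := hb_infsup
  let A : E →L[ℝ] E :=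
    (InnerProductSpace.toDual ℝ E).symm.toContinuousLinearEquiv.toContinuousLinearMap ∘L
      a.mkContinuous₂ Ca hCa
  let B : V →L[ℝ] E :=
    (InnerProductSpace.toDual ℝ E).symm.toContinuousLinearEquiv.toContinuousLinearMap ∘L
      b.flip.mkContinuous₂ Cb fun v τ => (hCb τ v).trans_eq (mul_right_comm _ _ _)
  have hA : ∀ σ τ, ⟪A σ, τ⟫ = a σ τ := fun σ τ => by
    simp [A, InnerProductSpace.toDual_symm_apply]
  have hB : ∀ v τ, ⟪B v, τ⟫ = b τ v := fun v τ => by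
    simp only [B, ContinuousLinearMap.comp_apply]
    exact InnerProductSpace.toDual_symm_apply
  have hBadj : ∀ σ v, ⟪ContinuousLinearMap.adjoint B σ, v⟫ = b σ v := fun σ v => by
    rw [ContinuousLinearMap.adjoint_inner_left, real_inner_comm, hB]
  have hBbelow : ∀ v, β * ‖v‖ ≤ ‖B v‖ := fun v =>
    le_norm_of_le_iSup_inner_div_norm (by simpa only [hB] using hinf v)
  intro κ l
  obtain ⟨σ, u, h₁, h₂⟩ := exists_saddle_point A B hα hβ
    (fun σ hσ => by
      rw [hA]
      exact hell σ fun v => by rw [← hBadj, hσ, inner_zero_left]) hBbelow κ l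
  have e₁ : ∀ τ, a σ τ + b τ u = ⟪κ, τ⟫ := fun τ => by
    rw [← hA, ← hB, ← inner_add_left, h₁]
  have e₂ : ∀ v, b σ v = ⟪l, v⟫ := fun v => by rw [← hBadj, h₂]
  refine ⟨(σ, u), ⟨e₁, e₂⟩, ?_⟩
  rintro ⟨σ', u'⟩ ⟨e₁', e₂'⟩
  dsimp only at e₁' e₂'
  have hZ : ∀ v, b (σ' - σ) v = 0 := fun v => by
    rw [map_sub, LinearMap.sub_apply, e₂', e₂, sub_self]
  have haδ : a (σ' - σ) (σ' - σ) = 0 := by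
    have h := e₁' (σ' - σ)
    rw [hZ, ← e₁ (σ' - σ), hZ] at h
    rw [LinearMap.map_sub₂]
    linarith
  have hσ : σ' = σ := by
    have h := hell _ hZ
    rw [haδ] at h
    have h0 : ‖σ' - σ‖ ^ 2 ≤ 0 := nonpos_of_mul_nonpos_right h hα
    exact sub_eq_zero.1 (norm_eq_zero.1 (pow_eq_zero_iff two_ne_zero |>.1
      (le_antisymm h0 (sq_nonneg _))))
  subst hσ
  have hBu : B (u' - u) = 0 := ext_inner_right ℝ fun τ => by
    rw [hB, map_sub, inner_zero_left]
    linarith [e₁ τ, e₁' τ]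
  have hu : u' = u := by
    have h := hBbelow (u' - u)
    rw [hBu, norm_zero] at h
    exact sub_eq_zero.1 (norm_le_zero_iff.1 (nonpos_of_mul_nonpos_right h hβ))
  rw [hu]
end

section
/- For a dissipative unbounded operator on a real Hilbert space, maximality at one positive parameter implies maximality at all: if X is a real Hilbert space, A is a linear operator defined on a subspace D(A) ⊆ X with values in X satisfying ⟨A y, y⟩ ≤ 0 for all y ∈ D(A), and there exists λ₀ > 0 such that the range of λ₀ I − A (i.e. { λ₀ y − A y : y ∈ D(A) }) is all of X, then for every λ > 0 the range of λ I − A is all of X. -/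
open scoped RealInnerProductSpace

/-- For a dissipative operator, `λ I - A` is bounded below by `λ`. -/
theorem mul_norm_le_norm_smul_sub_of_dissipative
    {X : Type*} [NormedAddCommGroup X] [InnerProductSpace ℝ X]
    {D : Submodule ℝ X} {A : D →ₗ[ℝ] X} (hdiss : ∀ y : D, ⟪A y, (y : X)⟫ ≤ 0)
    (m : ℝ) (y : D) : m * ‖(y : X)‖ ≤ ‖m • (y : X) - A y‖ := by
  have h := real_inner_le_norm (m • (y : X) - A y) (y : X)
  rw [inner_sub_left, real_inner_smul_left, real_inner_self_eq_norm_sq] at h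
  rcases (norm_nonneg (y : X)).eq_or_lt with h0 | h0
  · rw [← h0, mul_zero]
    exact norm_nonneg _
  · refine le_of_mul_le_mul_right ?_ h0
    linarith [hdiss y, sq ‖(y : X)‖, mul_assoc m ‖(y : X)‖ ‖(y : X)‖,
      congrArg (m * ·) (sq ‖(y : X)‖)]

/-- For a dissipative operator, surjectivity of `m I - A` with `m > 0` propagates to `l I - A` for
all `l` with `|m - l| < m`. -/
theorem exists_smul_sub_eq_of_dissipative_of_abs_sub_lt
    {X : Type*} [NormedAddCommGroup X] [InnerProductSpace ℝ X] [CompleteSpace X]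
    {D : Submodule ℝ X} {A : D →ₗ[ℝ] X} (hdiss : ∀ y : D, ⟪A y, (y : X)⟫ ≤ 0)
    {m l : ℝ} (hsurj : ∀ x : X, ∃ y : D, m • (y : X) - A y = x) (hlm : |m - l| < m) (x : X) :
    ∃ y : D, l • (y : X) - A y = x := by
  have hm : 0 < m := (abs_nonneg _).trans_lt hlm
  choose R hR using hsurj
  have hlip (u v : X) : m * ‖(R u : X) - R v‖ ≤ ‖u - v‖ := by
    have h := mul_norm_le_norm_smul_sub_of_dissipative hdiss m (R u - R v)
    have e : m • ((R u - R v : D) : X) - A (R u - R v) = u - v := by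
      nth_rewrite 3 [← hR u]
      nth_rewrite 3 [← hR v]
      rw [map_sub, Submodule.coe_sub, smul_sub]
      abel
    rwa [e, Submodule.coe_sub] at h
  have hK : 0 ≤ |m - l| / m := by positivity
  have hT : ContractingWith ⟨|m - l| / m, hK⟩ fun w => x + (m - l) • (R w : X) := by
    refine ⟨NNReal.coe_lt_coe.1 ((div_lt_one hm).2 hlm), LipschitzWith.of_dist_le_mul fun u v => ?_⟩
    rw [dist_add_left, dist_eq_norm, ← smul_sub, norm_smul, Real.norm_eq_abs, dist_eq_norm]
    change _ ≤ |m - l| / m * ‖u - v‖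
    rw [div_mul_eq_mul_div, mul_div_assoc]
    gcongr
    rw [le_div_iff₀' hm]
    exact hlip u v
  have hfix : x + (m - l) • (R hT.fixedPoint : X) = hT.fixedPoint := hT.fixedPoint_isFixedPt
  refine ⟨R hT.fixedPoint, ?_⟩
  have h := (hR hT.fixedPoint).trans hfix.symm
  rw [sub_smul, ← sub_eq_iff_eq_add'] at h
  have h' := sub_eq_zero.2 h
  rw [← sub_eq_zero, ← h']
  abel

/-- **Maximality at one positive parameter implies maximality at all.**
If `X` is a real Hilbert space, `A` a linear operator defined on a subspace
`D(A) ⊆ X` with values in `X` satisfying `⟨A y, y⟩ ≤ 0` for all `y ∈ D(A)`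
(dissipativity), and there exists `λ₀ > 0` such that the range of `λ₀ I − A`
is all of `X`, then for every `λ > 0` the range of `λ I − A` is all of `X`. -/
theorem dissipative_maximal_of_maximal_at_one_param
    {X : Type*} [NormedAddCommGroup X] [InnerProductSpace ℝ X] [CompleteSpace X]
    (D : Submodule ℝ X) (A : D →ₗ[ℝ] X)
    (hdiss : ∀ y : D, ⟪A y, (y : X)⟫ ≤ 0)
    (hmax : ∃ l₀ : ℝ, 0 < l₀ ∧ ∀ x : X, ∃ y : D, l₀ • (y : X) - A y = x) :
    ∀ l : ℝ, 0 < l → ∀ x : X, ∃ y : D, l • (y : X) - A y = x := by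
  obtain ⟨l₀, hl₀, hsurj⟩ := hmax
  intro l hl
  have hpow (n : ℕ) : ∀ x : X, ∃ y : D, (l₀ * (3 / 2) ^ n) • (y : X) - A y = x := by
    induction n with
    | zero => simpa using hsurj
    | succ n ih =>
      refine exists_smul_sub_eq_of_dissipative_of_abs_sub_lt hdiss ih ?_
      have hp : 0 < l₀ * (3 / 2) ^ n := by positivity
      rw [pow_succ, abs_lt]
      constructor <;> linarith
  obtain ⟨n, hn⟩ := pow_unbounded_of_one_lt (l / l₀) (by norm_num : (1 : ℝ) < 3 / 2)
  rw [div_lt_iff₀' hl₀] at hn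
  refine exists_smul_sub_eq_of_dissipative_of_abs_sub_lt hdiss (hpow n) ?_
  rw [abs_lt]
  constructor <;> linarith
end
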